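/- Let T be a finite tree, let v_1 be a centroid of T, and let (v_1, v_2, …, v_ℓ) be a path in T starting at v_1. Let ψ denote either closeness centrality C_T or rumor centrality φ_T. Then ψ(v_i) < ψ(v_{i+1}) for all 2 ≤ i ≤ ℓ−1, and ψ(v_1) ≤ ψ(v_2), with equality only when v_1 and v_2 are the two unique centroids of T. -/

import Mathlib

open SimpleGraph Finset

variable {V : Type*} [Fintype V] [DecidableEq V]

/-- `(T,v)_{u↓}`: the set of vertices `w` whose unique path to `v` passes through `u`. -/
def subtreeSet (T : SimpleGraph V) (v u : V) : Set V :=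
  {w | ∀ p : T.Path w v, u ∈ p.1.support}

/-- `|(T,v)_{u↓}|` -/
noncomputable def subtreeCard (T : SimpleGraph V) (v u : V) : ℕ :=
  Nat.card (subtreeSet T v u)

/-- Closeness centrality `C_T(v) = Σ_{u ≠ v} dist(v,u)`; smaller is more central. -/
noncomputable def closeness (T : SimpleGraph V) (v : V) : ℕ :=
  ∑ u ∈ Finset.univ.erase v, T.dist v u

/-- Rumor centrality `φ_T(v) = Π_{u ≠ v} |(T,v)_{u↓}|`; smaller is more central. -/
noncomputable def rumor (T : SimpleGraph V) (v : V) : ℕ :=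
  ∏ u ∈ Finset.univ.erase v, subtreeCard T v u

/-- A centroid of `T`: removing `v` leaves a forest in which every connected
component has at most `n/2` vertices. -/
def IsCentroid (T : SimpleGraph V) (v : V) : Prop :=
  ∀ C : (T.induce {u | u ≠ v}).ConnectedComponent,
    2 * Nat.card C.supp ≤ Fintype.card V

theorem mem_subtreeSet_iff {W : Type*} {T : SimpleGraph W} (hT : T.IsTree) {v u w : W}
    {p : T.Walk w v}
    (hp : p.IsPath) : w ∈ subtreeSet T v u ↔ u ∈ p.support := by
  refine ⟨fun h => h ⟨p, hp⟩, fun h q => ?_⟩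
  rwa [show q = ⟨p, hp⟩ from (hT.isAcyclic.subsingleton_path w v).elim _ _]

theorem self_mem_subtreeSet {W : Type*} (T : SimpleGraph W) (v u : W) : u ∈ subtreeSet T v u :=
  fun p => p.1.start_mem_support

theorem subtreeCard_pos {W : Type*} [Fintype W] (T : SimpleGraph W) (v u : W)
    : 0 < subtreeCard T v u := by
  have : Nonempty (subtreeSet T v u) := ⟨⟨u, self_mem_subtreeSet T v u⟩⟩
  exact Nat.card_pos

theorem mem_subtreeSet_adj_comm {W : Type*} {T : SimpleGraph W} (hT : T.IsTree) {a b : W}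
    (h : T.Adj a b)
    (w : W) : w ∈ subtreeSet T b a ↔ w ∉ subtreeSet T a b := by
  obtain ⟨p, hp, -⟩ := hT.connected.exists_path_of_dist w a
  obtain ⟨q, hq, -⟩ := hT.connected.exists_path_of_dist w b
  rw [mem_subtreeSet_iff hT hp, mem_subtreeSet_iff hT hq]
  constructor
  · exact fun ha hb =>
      hT.isAcyclic.ne_mem_support_of_support_of_adj_of_isPath hp hq h hb ha
  · exact fun hb => hT.isAcyclic.mem_support_of_ne_mem_support_of_adj_of_isPath hq hp h.symm hb

theorem dist_of_mem_subtreeSet {W : Type*} {T : SimpleGraph W} (hT : T.IsTree) {a b : W}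
    (h : T.Adj a b)
    {w : W} (hw : w ∈ subtreeSet T a b) : T.dist w a = T.dist w b + 1 := by
  obtain ⟨p, hp, hpl⟩ := hT.connected.exists_path_of_dist w a
  obtain ⟨q, hq, hql⟩ := hT.connected.exists_path_of_dist w b
  rw [mem_subtreeSet_iff hT hp] at hw
  rw [← hpl, ← hql, hT.isAcyclic.path_concat hq hp h.symm hw, Walk.length_concat]

theorem subtreeCard_adj_add {W : Type*} [Fintype W] {T : SimpleGraph W} (hT : T.IsTree) {a b : W}
    (h : T.Adj a b) :
    subtreeCard T a b + subtreeCard T b a = Fintype.card W := by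
  have hcompl : subtreeSet T b a = (subtreeSet T a b)ᶜ :=
    Set.ext fun w => mem_subtreeSet_adj_comm hT h w
  rw [subtreeCard, subtreeCard, hcompl, Nat.card_coe_set_eq, Nat.card_coe_set_eq,
    Set.ncard_add_ncard_compl, Nat.card_eq_fintype_card]

theorem subtreeSet_subset_of_adj {W : Type*} [DecidableEq W] {T : SimpleGraph W} {a b u : W}
    (h : T.Adj a b) (hua : u ≠ a) :
    subtreeSet T a u ⊆ subtreeSet T b u := by
  rintro w hw ⟨q, hq⟩
  by_cases ha : a ∈ q.support
  · exact q.support_takeUntil_subset_support ha (hw ⟨_, hq.takeUntil ha⟩)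
  · have := hw ⟨_, hq.concat ha h.symm⟩
    simpa [Walk.support_concat, hua] using this

theorem subtreeCard_eq_of_adj {W : Type*} [DecidableEq W] {T : SimpleGraph W} {a b u : W}
    (h : T.Adj a b) (hua : u ≠ a)
    (hub : u ≠ b) : subtreeCard T a u = subtreeCard T b u := by
  rw [subtreeCard, subtreeCard, (subtreeSet_subset_of_adj h hua).antisymm
    (subtreeSet_subset_of_adj h.symm hub)]

theorem subtreeCard_lt_of_adj_adj {W : Type*} [Fintype W] {T : SimpleGraph W} (hT : T.IsTree)
    {a b c : W}
    (hab : T.Adj a b) (hbc : T.Adj b c) (hac : a ≠ c) :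
    subtreeCard T b c < subtreeCard T a b := by
  rw [subtreeCard, subtreeCard, Nat.card_coe_set_eq, Nat.card_coe_set_eq]
  refine Set.ncard_lt_ncard (Set.ssubset_iff_exists.mpr
    ⟨fun w hw => ?_, b, self_mem_subtreeSet T a b, fun hb => ?_⟩) (Set.toFinite _)
  · by_contra hwa
    rw [← mem_subtreeSet_adj_comm hT hab] at hwa
    obtain ⟨p, hp, -⟩ := hT.connected.exists_path_of_dist w b
    rw [mem_subtreeSet_iff hT hp] at hw hwa
    exact hac ((hT.isAcyclic.eq_penultimate_of_adj_end hp hab.symm hwa).trans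
      (hT.isAcyclic.eq_penultimate_of_adj_end hp hbc hw).symm)
  · rw [mem_subtreeSet_iff hT Walk.IsPath.nil] at hb
    exact hbc.ne' (by simpa using hb)

theorem closeness_eq_sum (T : SimpleGraph V) (v : V) : closeness T v = ∑ u, T.dist u v := by
  simp_rw [T.dist_comm (v := v)]
  exact Finset.sum_erase _ (by simp)

theorem closeness_add_subtreeCard {T : SimpleGraph V} (hT : T.IsTree) {a b : V} (h : T.Adj a b) :
    closeness T a + subtreeCard T b a = closeness T b + subtreeCard T a b := by
  classical
  have hcard : ∀ x y, subtreeCard T x y = ∑ w, if w ∈ subtreeSet T x y then 1 else 0 := by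
    intro x y
    rw [subtreeCard, Nat.card_eq_fintype_card, Fintype.card_subtype, Finset.card_filter]
  rw [closeness_eq_sum, closeness_eq_sum, hcard, hcard, ← Finset.sum_add_distrib,
    ← Finset.sum_add_distrib]
  refine Finset.sum_congr rfl fun w _ => ?_
  by_cases hw : w ∈ subtreeSet T a b
  · have hw' : w ∉ subtreeSet T b a := fun hba => (mem_subtreeSet_adj_comm hT h w).1 hba hw
    simp [hw, hw', dist_of_mem_subtreeSet hT h hw]
  · have hw' := (mem_subtreeSet_adj_comm hT h w).2 hw
    simp [hw, hw', dist_of_mem_subtreeSet hT h.symm hw']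

theorem exists_rumor_eq_mul (T : SimpleGraph V) {a b : V} (h : T.Adj a b) :
    ∃ P, 0 < P ∧ rumor T a = subtreeCard T a b * P ∧ rumor T b = subtreeCard T b a * P := by
  refine ⟨∏ u ∈ (Finset.univ.erase a).erase b, subtreeCard T a u,
    Finset.prod_pos fun u _ => subtreeCard_pos T a u, ?_, ?_⟩
  · exact (Finset.mul_prod_erase _ _ (by simp [h.ne'])).symm
  · rw [rumor, ← Finset.mul_prod_erase _ _ (show a ∈ Finset.univ.erase b by simp [h.ne]),
      Finset.erase_right_comm]
    congr 1
    refine Finset.prod_congr rfl fun u hu => ?_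
    simp only [Finset.mem_erase] at hu
    exact subtreeCard_eq_of_adj h.symm (by tauto) (by tauto)

theorem centrality_lt_iff_of_adj {T : SimpleGraph V} (hT : T.IsTree) {ψ : V → ℕ}
    (hψ : ψ = closeness T ∨ ψ = rumor T) {a b : V} (h : T.Adj a b) :
    ψ a < ψ b ↔ subtreeCard T a b < subtreeCard T b a := by
  rcases hψ with rfl | rfl
  · have := closeness_add_subtreeCard hT h
    omega
  · obtain ⟨P, hP, ha, hb⟩ := exists_rumor_eq_mul T h
    rw [ha, hb, Nat.mul_lt_mul_right hP]

theorem mem_subtreeSet_of_adj {W : Type*} [DecidableEq W] {T : SimpleGraph W} (hT : T.IsTree)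
    {a b y z : W}
    (hab : T.Adj a b) (hyz : T.Adj y z) (hza : z ≠ a) (hy : y ∈ subtreeSet T a b) :
    z ∈ subtreeSet T a b := by
  obtain ⟨q, hq, -⟩ := hT.connected.exists_path_of_dist z a
  rw [mem_subtreeSet_iff hT hq]
  by_cases hyq : y ∈ q.support
  · exact q.support_dropUntil_subset_support hyq (hy ⟨_, hq.dropUntil hyq⟩)
  · have hcons : (Walk.cons hyz q).IsPath := hq.cons hyq
    have hb := hy ⟨_, hcons⟩
    rw [Walk.support_cons, List.mem_cons] at hb
    refine hb.resolve_left ?_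
    rintro rfl
    have := hT.isAcyclic.eq_snd_of_adj_start hcons hab.symm (Walk.end_mem_support _)
    exact hza (by simpa using this.symm)

theorem isCentroid_iff {T : SimpleGraph V} (hT : T.IsTree) (a : V) :
    IsCentroid T a ↔ ∀ b, T.Adj a b → 2 * subtreeCard T a b ≤ Fintype.card V := by
  constructor
  · intro ha b hb
    let b' : {u | u ≠ a} := ⟨b, hb.ne'⟩
    refine le_trans ?_ (ha ((T.induce {u | u ≠ a}).connectedComponentMk b'))
    rw [subtreeCard, Nat.card_coe_set_eq, Nat.card_coe_set_eq,
      ← Set.ncard_image_of_injective _ Subtype.val_injective]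
    refine Nat.mul_le_mul_left 2 (Set.ncard_le_ncard (fun w hw => ?_) (Set.toFinite _))
    obtain ⟨p, hp, -⟩ := hT.connected.exists_path_of_dist w b
    have hap : a ∉ p.support := by
      rw [← mem_subtreeSet_iff hT hp, mem_subtreeSet_adj_comm hT hb]
      exact not_not.mpr hw
    have hp' : ∀ u ∈ p.support, u ∈ {u | u ≠ a} := fun u hu => ne_of_mem_of_not_mem hu hap
    exact ⟨⟨w, hp' w p.start_mem_support⟩,
      SimpleGraph.ConnectedComponent.sound (p.induce _ hp').reachable, rfl⟩
  · intro ha C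
    induction C using SimpleGraph.ConnectedComponent.ind with | _ x =>
    obtain ⟨p, hp, -⟩ := hT.connected.exists_path_of_dist x.1 a
    have hadj : T.Adj a p.penultimate :=
      (p.adj_penultimate (Walk.not_nil_of_ne x.2)).symm
    refine le_trans ?_ (ha _ hadj)
    set b := p.penultimate
    rw [subtreeCard, Nat.card_coe_set_eq, Nat.card_coe_set_eq,
      ← Set.ncard_image_of_injective _ Subtype.val_injective]
    refine Nat.mul_le_mul_left 2 (Set.ncard_le_ncard ?_ (Set.toFinite _))
    rintro _ ⟨w, hw, rfl⟩
    have hx : x.1 ∈ subtreeSet T a b :=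
      (mem_subtreeSet_iff hT hp).2 (p.getVert_mem_support _)
    obtain ⟨q⟩ := (SimpleGraph.ConnectedComponent.exact hw).symm
    have hclosed : ∀ {y z : {u | u ≠ a}}, (T.induce {u | u ≠ a}).Walk y z →
        y.1 ∈ subtreeSet T a b → z.1 ∈ subtreeSet T a b := by
      intro y z q
      induction q with
      | nil => exact id
      | @cons y z _ hyz _ ih =>
        exact fun hy => ih (mem_subtreeSet_of_adj hT hadj (induce_adj.1 hyz) z.2 hy)
    exact hclosed q hx

theorem eq_of_isCentroid_of_path {T : SimpleGraph V} (hT : T.IsTree) {b w : V} (p : T.Walk b w)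
    (hw : IsCentroid T w) : ∀ {a : V} (h : T.Adj a b), (Walk.cons h p).IsPath →
      2 * subtreeCard T a b ≤ Fintype.card V → w = b := by
  induction p with
  | nil => exact fun _ _ _ => rfl
  | @cons b c _ hbc p ih =>
    intro a h hp hcard
    have hac : a ≠ c := by
      rintro rfl
      simp at hp
    have hlt := subtreeCard_lt_of_adj_adj hT h hbc hac
    obtain rfl := ih hw hbc hp.of_cons (by omega)
    have := (isCentroid_iff hT _).1 hw b hbc.symm
    have := subtreeCard_adj_add hT hbc
    omega

/-- Monotonicity of closeness/rumor centrality along a path started at a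
centroid `v 0`: `ψ(v i) < ψ(v (i+1))` for `1 ≤ i ≤ ℓ-2` (0-indexed), and
`ψ(v 0) ≤ ψ(v 1)` with equality only when `v 0` and `v 1` are the two unique
centroids. -/
theorem centrality_monotone_along_path (T : SimpleGraph V) (hT : T.IsTree)
    (ℓ : ℕ) (hℓ : 1 ≤ ℓ) (v : ℕ → V)
    (hadj : ∀ i, i + 1 < ℓ → T.Adj (v i) (v (i + 1)))
    (hinj : ∀ i j, i < ℓ → j < ℓ → v i = v j → i = j)
    (hcentroid : IsCentroid T (v 0))
    (ψ : V → ℕ) (hψ : ψ = closeness T ∨ ψ = rumor T) :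
    (∀ i, 1 ≤ i → i + 1 < ℓ → ψ (v i) < ψ (v (i + 1))) ∧
    (2 ≤ ℓ → ψ (v 0) ≤ ψ (v 1) ∧
      (ψ (v 0) = ψ (v 1) →
        IsCentroid T (v 0) ∧ IsCentroid T (v 1) ∧ v 0 ≠ v 1 ∧
        ∀ w : V, IsCentroid T w → w = v 0 ∨ w = v 1)) := by
  have hcent := (isCentroid_iff hT _).1 hcentroid
  have hstep : ∀ i, i + 2 < ℓ →
      subtreeCard T (v (i + 1)) (v (i + 1 + 1)) < subtreeCard T (v i) (v (i + 1)) := fun i hi =>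
    subtreeCard_lt_of_adj_adj hT (hadj i (by omega)) (hadj (i + 1) hi) fun h => by
      have := hinj i (i + 2) (by omega) hi h
      omega
  have hle : ∀ i, i + 1 < ℓ → 2 * subtreeCard T (v i) (v (i + 1)) ≤ Fintype.card V := by
    intro i
    induction i with
    | zero => exact fun h => hcent _ (hadj 0 h)
    | succ i ih =>
      intro h
      have := ih (by omega)
      have := hstep i h
      omega
  refine ⟨fun i hi h => ?_, fun h => ?_⟩
  · obtain ⟨j, rfl⟩ := Nat.exists_eq_add_of_le' hi
    rw [centrality_lt_iff_of_adj hT hψ (hadj _ h)]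
    have := hle j (by omega)
    have := hstep j h
    have := subtreeCard_adj_add hT (hadj _ h)
    omega
  · have h01 : T.Adj (v 0) (v 1) := hadj 0 h
    have hsum := subtreeCard_adj_add hT h01
    have h0 := hcent _ h01
    have hlt := centrality_lt_iff_of_adj hT hψ h01
    have hlt' := centrality_lt_iff_of_adj hT hψ h01.symm
    refine ⟨by omega, fun heq => ?_⟩
    have hhalf : 2 * subtreeCard T (v 1) (v 0) ≤ Fintype.card V := by omega
    refine ⟨hcentroid, (isCentroid_iff hT _).2 fun c hc => ?_, h01.ne, fun w hw => ?_⟩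
    · by_cases hc0 : v 0 = c
      · exact hc0 ▸ hhalf
      · have := subtreeCard_lt_of_adj_adj hT h01 hc hc0
        omega
    · obtain ⟨p, hp, -⟩ := hT.connected.exists_path_of_dist (v 0) w
      obtain ⟨q, hq, -⟩ := hT.connected.exists_path_of_dist (v 1) w
      by_cases hq0 : v 0 ∈ q.support
      · refine .inl (eq_of_isCentroid_of_path hT p hw h01.symm (hp.cons fun hp1 => ?_) hhalf)
        refine hT.isAcyclic.ne_mem_support_of_support_of_adj_of_isPath hp.reverse hq.reverse h01
          ?_ ?_ <;> simpa
      · exact .inr (eq_of_isCentroid_of_path hT q hw h01 (hq.cons hq0) h0)
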